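/- arXiv:1107.3177 — 4 statements merged into one kernel-verified Lean document; each statement's English description precedes it below -/
import Mathlib

section
/- Suppose 0 ≤ β(d_v−1)(d_c−1) < 1, let μ* be the fixed point of the AMP operator A, suppose that for each edge (i,j) ∈ E the bit x*_{i,j} ∈ {0,1} uniquely maximizes x ↦ μ*_{i→j}(x), and suppose the assignment {x*_{i,j}} is AMP-consistent with common values x*_i. Then Σ_{(i,j)∈E} μ*_{i→j}(x*_{i,j}) = d_v · Σ_{i∈V_L} (1−x*_i)γ_i / (1 − β(d_v−1)(d_c−1)). -/
open Finset Filter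

/-- The real value of a bit. -/
def bv (b : Bool) : ℝ := if b then 1 else 0

/-- `Skin Nc k i x` : the set of local assignments `w` with `w i = x` and even parity
on the neighborhood of check node `k` (the set `S_{k,i}(x)`). -/
def Skin {VL VR : Type*} [Fintype VL] [DecidableEq VL]
    (Nc : VR → Finset VL) (k : VR) (i : VL) (x : Bool) : Finset (VL → Bool) :=
  Finset.univ.filter (fun w => w i = x ∧ Even (((Nc k).filter (fun m => w m = true)).card))

/-- The AMP operator `A`:
`(A[μ])_{i→j}(x) = (1−x)·γ_i + β·Σ_{k∈N(i)\{j}} max_{w∈S_{k,i}(x)} Σ_{m∈N(k)\{i}} μ_{m→k}(w_m)`. -/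
noncomputable def Aop {VL VR : Type*} [Fintype VL] [DecidableEq VL] [DecidableEq VR]
    (Nv : VL → Finset VR) (Nc : VR → Finset VL) (γ : VL → ℝ) (β : ℝ)
    (μ : VL → VR → Bool → ℝ) : VL → VR → Bool → ℝ :=
  fun i j x => (1 - bv x) * γ i +
    β * ∑ k ∈ (Nv i).erase j,
      ⨆ w : {w : VL → Bool // w ∈ Skin Nc k i x}, ∑ m ∈ (Nc k).erase i, μ m k (w.1 m)

/-- Sup-norm over edges (and bits) of an AMP message vector. -/
noncomputable def ampSup {VL VR : Type*} (Nv : VL → Finset VR)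
    (μ : VL → VR → Bool → ℝ) : ℝ :=
  ⨆ p : {q : (VL × VR) × Bool // q.1.2 ∈ Nv q.1.1}, |μ p.1.1.1 p.1.1.2 p.1.2|

/-- The finset of edges of the Tanner graph. -/
def Edges {VL VR : Type*} [Fintype VL] [Fintype VR] [DecidableEq VR]
    (Nv : VL → Finset VR) : Finset (VL × VR) :=
  Finset.univ.filter (fun p => p.2 ∈ Nv p.1)

/-- AMP-consistency of an edge-indexed family of bits: for each variable node all incident
edges carry the same bit, and the resulting vector of common bits is a codeword. -/
def AMPConsistent {VL VR : Type*} (Nv : VL → Finset VR) (Nc : VR → Finset VL)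
    (xs : VL → VR → Bool) : Prop :=
  (∀ i : VL, ∀ j ∈ Nv i, ∀ j' ∈ Nv i, xs i j = xs i j') ∧
  (∀ k : VR, Even (((Nc k).filter (fun i => ∀ j ∈ Nv i, xs i j = true)).card))

/-- Summing over all punctured sums of a finite set counts every term `#s - 1` times. -/
theorem sum_sum_erase {α : Type*} [DecidableEq α] (s : Finset α) (f : α → ℝ) :
    ∑ a ∈ s, ∑ b ∈ s.erase a, f b = ((s.card : ℝ) - 1) * ∑ b ∈ s, f b := by
  have h : ∀ a ∈ s, ∑ b ∈ s.erase a, f b = ∑ b ∈ s, f b - f a := fun a ha => by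
    rw [← Finset.add_sum_erase s f ha]
    ring
  rw [Finset.sum_congr rfl h, Finset.sum_sub_distrib, Finset.sum_const, nsmul_eq_mul]
  ring

/-- If the local word of a codeword `v` at `k` maximizes every incoming message, then it attains
the maximum over local words compatible with `v i`. -/
theorem iSup_Skin_eq {VL VR : Type*} [Fintype VL] [DecidableEq VL]
    (Nc : VR → Finset VL) (k : VR) (i : VL) (v : VL → Bool)
    (hv : Even (((Nc k).filter (fun m => v m = true)).card)) (μ : VL → VR → Bool → ℝ)
    (hμ : ∀ m ∈ Nc k, ∀ b, μ m k b ≤ μ m k (v m)) :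
    (⨆ w : {w : VL → Bool // w ∈ Skin Nc k i (v i)}, ∑ m ∈ (Nc k).erase i, μ m k (w.1 m)) =
      ∑ m ∈ (Nc k).erase i, μ m k (v m) := by
  have hmem : v ∈ Skin Nc k i (v i) := by simp [Skin, hv]
  have : Nonempty {w : VL → Bool // w ∈ Skin Nc k i (v i)} := ⟨⟨v, hmem⟩⟩
  refine le_antisymm
    (ciSup_le fun w => Finset.sum_le_sum fun m hm => hμ m (Finset.mem_of_mem_erase hm) _) ?_
  exact le_ciSup (f := fun w : {w : VL → Bool // w ∈ Skin Nc k i (v i)} =>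
    ∑ m ∈ (Nc k).erase i, μ m k (w.1 m)) (Set.finite_range _).bddAbove ⟨v, hmem⟩

/-- When the uniquely maximizing bits of an AMP fixed point are
AMP-consistent with common values `xv`, the edge-sum of the fixed-point values equals
`d_v · Σ_i (1−x*_i)γ_i / (1 − β(d_v−1)(d_c−1))`. -/
theorem amp_fixed_point_sum_eq
    {VL VR : Type*} [Fintype VL] [Fintype VR] [DecidableEq VL] [DecidableEq VR]
    [Nonempty VL] [Nonempty VR]
    (Nv : VL → Finset VR) (Nc : VR → Finset VL) (dv dc : ℕ)
    (hsym : ∀ (i : VL) (j : VR), j ∈ Nv i ↔ i ∈ Nc j)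
    (hdv : ∀ i : VL, (Nv i).card = dv) (hdc : ∀ j : VR, (Nc j).card = dc)
    (hdv2 : 2 ≤ dv) (hdc2 : 2 ≤ dc)
    (γ : VL → ℝ) (β : ℝ)
    (hβ0 : 0 ≤ β * ((dv : ℝ) - 1) * ((dc : ℝ) - 1))
    (hβ1 : β * ((dv : ℝ) - 1) * ((dc : ℝ) - 1) < 1)
    (μs : VL → VR → Bool → ℝ)
    (hfix : ∀ i : VL, ∀ j ∈ Nv i, ∀ x : Bool, μs i j x = Aop Nv Nc γ β μs i j x)
    (xs : VL → VR → Bool)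
    (hmax : ∀ i : VL, ∀ j ∈ Nv i, ∀ b : Bool, b ≠ xs i j → μs i j b < μs i j (xs i j))
    (hcons : AMPConsistent Nv Nc xs)
    (xv : VL → Bool) (hxv : ∀ i : VL, ∀ j ∈ Nv i, xs i j = xv i) :
    ∑ p ∈ Edges Nv, μs p.1 p.2 (xs p.1 p.2) =
      (dv : ℝ) * (∑ i : VL, (1 - bv (xv i)) * γ i) /
        (1 - β * ((dv : ℝ) - 1) * ((dc : ℝ) - 1)) := by
  have hv : ∀ k, Even (((Nc k).filter (fun m => xv m = true)).card) := fun k => by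
    convert hcons.2 k using 2
    ext i
    simp only [Finset.mem_filter]
    refine and_congr_right fun hi => ⟨fun h j hj => (hxv i j hj).trans h, fun h => ?_⟩
    have hk := (hsym i k).2 hi
    exact (hxv i k hk).symm.trans (h k hk)
  have hle : ∀ k, ∀ m ∈ Nc k, ∀ b, μs m k b ≤ μs m k (xv m) := fun k m hm b => by
    have hk := (hsym m k).2 hm
    rw [← hxv m k hk]
    by_cases hb : b = xs m k
    · rw [hb]
    · exact (hmax m k hk b hb).le
  have hedges : ∀ f : VL → VR → ℝ, ∑ p ∈ Edges Nv, f p.1 p.2 = ∑ i, ∑ j ∈ Nv i, f i j :=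
    fun f => Finset.sum_finset_product' _ _ _ (by simp [Edges])
  have hswap : ∀ f : VL → VR → ℝ, ∑ i, ∑ j ∈ Nv i, f i j = ∑ k, ∑ i ∈ Nc k, f i k :=
    fun f => Finset.sum_comm' (by simp [hsym])
  have hsum : ∑ p ∈ Edges Nv, μs p.1 p.2 (xs p.1 p.2) = ∑ i, ∑ j ∈ Nv i, μs i j (xv i) := by
    rw [hedges fun i j => μs i j (xs i j)]
    exact Finset.sum_congr rfl fun i _ => Finset.sum_congr rfl fun j hj => by rw [hxv i j hj]
  have hloc : ∀ i, ∑ j ∈ Nv i, μs i j (xv i) = dv * ((1 - bv (xv i)) * γ i) +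
      β * (((dv : ℝ) - 1) * ∑ k ∈ Nv i, ∑ m ∈ (Nc k).erase i, μs m k (xv m)) := fun i => by
    have h : ∀ j ∈ Nv i, μs i j (xv i) = (1 - bv (xv i)) * γ i +
        β * ∑ k ∈ (Nv i).erase j, ∑ m ∈ (Nc k).erase i, μs m k (xv m) := fun j hj => by
      rw [hfix i j hj, Aop]
      simp_rw [fun k => iSup_Skin_eq Nc k i xv (hv k) μs (hle k)]
    rw [Finset.sum_congr rfl h, Finset.sum_add_distrib, Finset.sum_const, nsmul_eq_mul,
      ← Finset.mul_sum, sum_sum_erase, hdv]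
  have hcheck : ∑ i, ∑ k ∈ Nv i, ∑ m ∈ (Nc k).erase i, μs m k (xv m) =
      ((dc : ℝ) - 1) * ∑ i, ∑ j ∈ Nv i, μs i j (xv i) := by
    rw [hswap fun i k => ∑ m ∈ (Nc k).erase i, μs m k (xv m), hswap fun i k => μs i k (xv i),
      Finset.mul_sum]
    exact Finset.sum_congr rfl fun k _ => by rw [sum_sum_erase, hdc]
  have htotal : ∑ i, ∑ j ∈ Nv i, μs i j (xv i) = dv * ∑ i, (1 - bv (xv i)) * γ i +
      β * (((dv : ℝ) - 1) * (((dc : ℝ) - 1) * ∑ i, ∑ j ∈ Nv i, μs i j (xv i))) := by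
    rw [← hcheck]
    simp_rw [Finset.mul_sum (s := Finset.univ), ← Finset.sum_add_distrib]
    exact Finset.sum_congr rfl fun i _ => hloc i
  rw [hsum, eq_div_iff (by linarith)]
  linarith
end

section
/- For any (d_v,d_c)-regular Tanner graph, any LLR vector γ ∈ ℝ^{V_L} and any β ≥ 0, the WMS operator W_β satisfies ‖W_β[μ] − W_β[ν]‖_∞ ≤ β(d_v−1)·‖μ − ν‖_∞ for all μ, ν ∈ ℝ^E. In particular, if β(d_v−1) < 1 then W_β is a contraction on ℝ^E with respect to ‖·‖_∞ and has a unique fixed point μ*, to which the WMS iterates converge. -/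
open Finset Filter

/-- Check-to-bit message computed from a WMS message vector `μ`:
`μ_{i←k} = (Π_{m∈N(k)\{i}} sgn(μ_{m→k})) · min_{m∈N(k)\{i}} |μ_{m→k}|`. -/
noncomputable def c2b {VL VR : Type*} [DecidableEq VL]
    (Nc : VR → Finset VL) (μ : VL → VR → ℝ) (i : VL) (k : VR) : ℝ :=
  (∏ m ∈ (Nc k).erase i, Real.sign (μ m k)) *
    ⨅ m : {m : VL // m ∈ (Nc k).erase i}, |μ m.1 k|

/-- The weighted min-sum operator `W_β`:
`(W_β[μ])_{i→j} = γ_i + β·Σ_{k∈N(i)\{j}} μ_{i←k}`. -/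
noncomputable def Wop {VL VR : Type*} [DecidableEq VL] [DecidableEq VR]
    (Nv : VL → Finset VR) (Nc : VR → Finset VL) (γ : VL → ℝ) (β : ℝ)
    (μ : VL → VR → ℝ) : VL → VR → ℝ :=
  fun i j => γ i + β * ∑ k ∈ (Nv i).erase j, c2b Nc μ i k

/-- The WMS iterates, initialized with the channel LLRs: `μ^{(0)}_{i→j} = γ_i`,
`μ^{(ℓ+1)} = W_β[μ^{(ℓ)}]`. -/
noncomputable def wmsIter {VL VR : Type*} [DecidableEq VL] [DecidableEq VR]
    (Nv : VL → Finset VR) (Nc : VR → Finset VL) (γ : VL → ℝ) (β : ℝ) :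
    ℕ → VL → VR → ℝ :=
  fun n => (Wop Nv Nc γ β)^[n] (fun i _ => γ i)

/-- WMS-consistency of a message vector (with parameter `β`). -/
def WMSConsistent {VL VR : Type*} [DecidableEq VL] [DecidableEq VR]
    (Nv : VL → Finset VR) (Nc : VR → Finset VL) (γ : VL → ℝ) (β : ℝ)
    (μ : VL → VR → ℝ) : Prop :=
  (∀ i : VL, ∀ j ∈ Nv i, μ i j ≠ 0) ∧
  (∀ i : VL, ∀ j ∈ Nv i, ∀ j' ∈ Nv i, Real.sign (μ i j) = Real.sign (μ i j')) ∧
  (∀ i : VL, ∀ j ∈ Nv i, Real.sign (c2b Nc μ i j) = Real.sign (μ i j)) ∧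
  (∀ i : VL, ∀ j' ∈ Nv i,
    Real.sign (γ i + β * ∑ j ∈ Nv i, c2b Nc μ i j) = Real.sign (μ i j'))

/-- Hard decisions computed from a WMS message vector:
`x̂_i = (1 − sgn(γ_i + β·Σ_{j∈N(i)} μ_{i←j}))/2`. -/
noncomputable def hardDec {VL VR : Type*} [DecidableEq VL]
    (Nv : VL → Finset VR) (Nc : VR → Finset VL) (γ : VL → ℝ) (β : ℝ)
    (μ : VL → VR → ℝ) : VL → ℝ :=
  fun i => (1 - Real.sign (γ i + β * ∑ j ∈ Nv i, c2b Nc μ i j)) / 2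

/-- Sup-norm over edges of an edge-indexed family of reals. -/
noncomputable def edgeSup {VL VR : Type*} (Nv : VL → Finset VR) (f : VL → VR → ℝ) : ℝ :=
  ⨆ p : {q : VL × VR // q.2 ∈ Nv q.1}, |f p.1.1 p.1.2|

/-- Sup-norm `‖γ‖_∞` of the LLR vector. -/
noncomputable def gammaSup {VL : Type*} (γ : VL → ℝ) : ℝ := ⨆ i, |γ i|

/-- A codeword, as a real vector with entries in `{0, 1}` whose sum over each check
neighborhood is even. -/
def IsCodewordR {VL VR : Type*} (Nc : VR → Finset VL) (x : VL → ℝ) : Prop :=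
  (∀ i, x i = 0 ∨ x i = 1) ∧ ∀ j : VR, ∃ m : ℤ, ∑ i ∈ Nc j, x i = 2 * m

theorem abs_prod_sign_le_one {ι : Type*} (s : Finset ι) (x : ι → ℝ) :
    |∏ m ∈ s, Real.sign (x m)| ≤ 1 := by
  rw [Finset.abs_prod]
  refine Finset.prod_le_one (fun _ _ => abs_nonneg _) fun m _ => ?_
  rcases Real.sign_apply_eq (x m) with h | h | h <;> simp [h]

/-- If the signs of two reals differ, their distance is the sum of their absolute values. -/
theorem abs_add_abs_le_of_sign_ne {a b : ℝ} (h : Real.sign a ≠ Real.sign b) :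
    |a| + |b| ≤ |a - b| := by
  rcases lt_trichotomy a 0 with ha | rfl | ha
  · rcases le_or_gt 0 b with hb | hb
    · rw [abs_of_neg ha, abs_of_nonneg hb, abs_of_nonpos (by linarith)]; linarith
    · exact absurd (by rw [Real.sign_of_neg ha, Real.sign_of_neg hb]) h
  · simp
  · rcases le_or_gt b 0 with hb | hb
    · rw [abs_of_pos ha, abs_of_nonpos hb, abs_of_nonneg (by linarith)]; linarith
    · exact absurd (by rw [Real.sign_of_pos ha, Real.sign_of_pos hb]) h

theorem bddBelow_range_abs {ι : Type*} (x : ι → ℝ) : BddBelow (Set.range fun m => |x m|) :=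
  ⟨0, by rintro _ ⟨m, rfl⟩; exact abs_nonneg _⟩

theorem iInf_abs_le_add {ι : Type*} [Nonempty ι] {x y : ι → ℝ} {d : ℝ}
    (h : ∀ m, |x m - y m| ≤ d) : ⨅ m, |x m| ≤ (⨅ m, |y m|) + d := by
  rw [← sub_le_iff_le_add]
  refine le_ciInf fun m => ?_
  have h1 := ciInf_le (bddBelow_range_abs x) m
  have h2 := abs_sub_abs_le_abs_sub (x m) (y m)
  linarith [h m]

/-- The check-to-bit rule is nonexpansive in the sup norm. -/
theorem abs_c2b_sub_le {VL VR : Type*} [DecidableEq VL] (Nc : VR → Finset VL)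
    {μ ν : VL → VR → ℝ} {d : ℝ} (hd : 0 ≤ d) (i : VL) (k : VR)
    (h : ∀ m ∈ Nc k, |μ m k - ν m k| ≤ d) : |c2b Nc μ i k - c2b Nc ν i k| ≤ d := by
  unfold c2b
  have h' : ∀ m : {m : VL // m ∈ (Nc k).erase i}, |μ m.1 k - ν m.1 k| ≤ d :=
    fun m => h _ (Finset.mem_of_mem_erase m.2)
  have hP := abs_prod_sign_le_one ((Nc k).erase i) (fun m => μ m k)
  have hQ := abs_prod_sign_le_one ((Nc k).erase i) (fun m => ν m k)
  have hA : 0 ≤ ⨅ m : {m : VL // m ∈ (Nc k).erase i}, |μ m.1 k| :=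
    Real.iInf_nonneg fun _ => abs_nonneg _
  have hB : 0 ≤ ⨅ m : {m : VL // m ∈ (Nc k).erase i}, |ν m.1 k| :=
    Real.iInf_nonneg fun _ => abs_nonneg _
  rcases isEmpty_or_nonempty {m : VL // m ∈ (Nc k).erase i} with _ | _
  · simpa [Real.iInf_of_isEmpty] using hd
  by_cases hs : ∀ m ∈ (Nc k).erase i, Real.sign (μ m k) = Real.sign (ν m k)
  · rw [Finset.prod_congr rfl hs, ← mul_sub, abs_mul]
    have hAB := iInf_abs_le_add h'
    have hBA := iInf_abs_le_add fun m => (abs_sub_comm (ν m.1 k) (μ m.1 k)).trans_le (h' m)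
    exact (mul_le_of_le_one_left (abs_nonneg _) hQ).trans
      (abs_sub_le_iff.2 ⟨by linarith, by linarith⟩)
  · push Not at hs
    obtain ⟨m, hm, hne⟩ := hs
    have h1 := ciInf_le (bddBelow_range_abs
      fun m : {m : VL // m ∈ (Nc k).erase i} => μ m.1 k) ⟨m, hm⟩
    have h2 := ciInf_le (bddBelow_range_abs
      fun m : {m : VL // m ∈ (Nc k).erase i} => ν m.1 k) ⟨m, hm⟩
    have h3 := abs_add_abs_le_of_sign_ne hne
    have h4 := h' ⟨m, hm⟩
    refine (abs_sub _ _).trans ?_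
    rw [abs_mul, abs_mul, abs_of_nonneg hA, abs_of_nonneg hB]
    have h5 := mul_le_of_le_one_left hA hP
    have h6 := mul_le_of_le_one_left hB hQ
    dsimp only at h1 h2 h4
    linarith

/-- Lipschitz bound for the WMS operator, edge by edge. -/
theorem abs_Wop_sub_le {VL VR : Type*} [DecidableEq VL] [DecidableEq VR]
    {Nv : VL → Finset VR} {Nc : VR → Finset VL} {dv : ℕ}
    (hsym : ∀ (i : VL) (j : VR), j ∈ Nv i ↔ i ∈ Nc j) (hdv : ∀ i : VL, (Nv i).card = dv)
    (γ : VL → ℝ) {β : ℝ} (hβ : 0 ≤ β) {μ ν : VL → VR → ℝ} {d : ℝ}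
    (h : ∀ i, ∀ j ∈ Nv i, |μ i j - ν i j| ≤ d) {i : VL} {j : VR} (hj : j ∈ Nv i) :
    |Wop Nv Nc γ β μ i j - Wop Nv Nc γ β ν i j| ≤ β * ((dv : ℝ) - 1) * d := by
  have hd : 0 ≤ d := (abs_nonneg _).trans (h i j hj)
  have hcard : (((Nv i).erase j).card : ℝ) = dv - 1 := by
    rw [Finset.cast_card_erase_of_mem hj, hdv]
  have hsum : |∑ k ∈ (Nv i).erase j, (c2b Nc μ i k - c2b Nc ν i k)| ≤ ((dv : ℝ) - 1) * d := by
    refine (Finset.abs_sum_le_sum_abs _ _).trans ((Finset.sum_le_card_nsmul _ _ d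
      fun k _ => abs_c2b_sub_le Nc hd i k fun m hm => h m k ((hsym m k).2 hm)).trans ?_)
    rw [nsmul_eq_mul, hcard]
  unfold Wop
  rw [add_sub_add_left_eq_sub, ← mul_sub, ← Finset.sum_sub_distrib, abs_mul, abs_of_nonneg hβ,
    mul_assoc]
  exact mul_le_mul_of_nonneg_left hsum hβ

theorem abs_le_edgeSup {VL VR : Type*} [Finite VL] [Finite VR] (Nv : VL → Finset VR)
    (f : VL → VR → ℝ) {i : VL} {j : VR} (hj : j ∈ Nv i) : |f i j| ≤ edgeSup Nv f :=
  le_ciSup (f := fun p : {q : VL × VR // q.2 ∈ Nv q.1} => |f p.1.1 p.1.2|)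
    (Set.finite_range _).bddAbove ⟨(i, j), hj⟩

theorem edgeSup_nonneg {VL VR : Type*} (Nv : VL → Finset VR) (f : VL → VR → ℝ) :
    0 ≤ edgeSup Nv f :=
  Real.iSup_nonneg fun _ => abs_nonneg _

/-- A contraction for the sup norm over edges has a fixed point on edges. -/
theorem exists_edge_fixedPoint {VL VR : Type*} [Fintype VL] [Fintype VR] [DecidableEq VR]
    (Nv : VL → Finset VR) (W : (VL → VR → ℝ) → VL → VR → ℝ) {K : ℝ} (hK0 : 0 ≤ K) (hK1 : K < 1)
    (hW : ∀ (μ ν : VL → VR → ℝ) (d : ℝ), (∀ i, ∀ j ∈ Nv i, |μ i j - ν i j| ≤ d) →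
      ∀ i, ∀ j ∈ Nv i, |W μ i j - W ν i j| ≤ K * d) :
    ∃ μ : VL → VR → ℝ, ∀ i, ∀ j ∈ Nv i, μ i j = W μ i j := by
  let extend (x : {q : VL × VR // q.2 ∈ Nv q.1} → ℝ) : VL → VR → ℝ :=
    fun i j => if h : j ∈ Nv i then x ⟨(i, j), h⟩ else 0
  let F (x : {q : VL × VR // q.2 ∈ Nv q.1} → ℝ) : {q : VL × VR // q.2 ∈ Nv q.1} → ℝ :=
    fun p => W (extend x) p.1.1 p.1.2
  have hF : ContractingWith ⟨K, hK0⟩ F := by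
    refine ⟨by exact_mod_cast hK1, LipschitzWith.of_dist_le_mul fun x y => ?_⟩
    refine (dist_pi_le_iff (mul_nonneg hK0 dist_nonneg)).2 fun p => ?_
    refine hW _ _ (dist x y) (fun i j hj => ?_) _ _ p.2
    simpa [extend, hj, Real.dist_eq] using dist_le_pi_dist x y ⟨(i, j), hj⟩
  refine ⟨extend hF.fixedPoint, fun i j hj => ?_⟩
  have hfix := congrFun hF.fixedPoint_isFixedPt ⟨(i, j), hj⟩
  simp only [extend, hj, dite_true]
  exact hfix.symm

/-- The WMS operator is Lipschitz with constant `β(d_v−1)` in the sup norm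
over edges; in particular, when `β(d_v−1) < 1` it is a contraction with a unique fixed point
(on edges), to which the WMS iterates converge. -/
theorem wms_operator_contraction
    {VL VR : Type*} [Fintype VL] [Fintype VR] [DecidableEq VL] [DecidableEq VR]
    [Nonempty VL] [Nonempty VR]
    (Nv : VL → Finset VR) (Nc : VR → Finset VL) (dv dc : ℕ)
    (hsym : ∀ (i : VL) (j : VR), j ∈ Nv i ↔ i ∈ Nc j)
    (hdv : ∀ i : VL, (Nv i).card = dv) (hdc : ∀ j : VR, (Nc j).card = dc)
    (hdv2 : 2 ≤ dv) (hdc2 : 2 ≤ dc)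
    (γ : VL → ℝ) (β : ℝ) (hβ : 0 ≤ β) :
    (∀ μ ν : VL → VR → ℝ,
      edgeSup Nv (fun i j => Wop Nv Nc γ β μ i j - Wop Nv Nc γ β ν i j)
        ≤ β * ((dv : ℝ) - 1) * edgeSup Nv (fun i j => μ i j - ν i j)) ∧
    (β * ((dv : ℝ) - 1) < 1 →
      ∃ μs : VL → VR → ℝ,
        (∀ i : VL, ∀ j ∈ Nv i, μs i j = Wop Nv Nc γ β μs i j) ∧
        (∀ ν : VL → VR → ℝ, (∀ i : VL, ∀ j ∈ Nv i, ν i j = Wop Nv Nc γ β ν i j) →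
          ∀ i : VL, ∀ j ∈ Nv i, ν i j = μs i j) ∧
        (∀ i : VL, ∀ j ∈ Nv i,
          Tendsto (fun n => wmsIter Nv Nc γ β n i j) atTop (nhds (μs i j)))) := by
  have hLip : ∀ (μ ν : VL → VR → ℝ) (d : ℝ), (∀ i, ∀ j ∈ Nv i, |μ i j - ν i j| ≤ d) →
      ∀ i, ∀ j ∈ Nv i, |Wop Nv Nc γ β μ i j - Wop Nv Nc γ β ν i j| ≤ β * ((dv : ℝ) - 1) * d :=
    fun _ _ _ h _ _ hj => abs_Wop_sub_le hsym hdv γ hβ h hj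
  have hK0 : 0 ≤ β * ((dv : ℝ) - 1) := by
    have : (2 : ℝ) ≤ dv := by exact_mod_cast hdv2
    exact mul_nonneg hβ (by linarith)
  have hsup (f : VL → VR → ℝ) : ∀ i, ∀ j ∈ Nv i, |f i j| ≤ edgeSup Nv f :=
    fun _ _ hj => abs_le_edgeSup Nv f hj
  have hcontr : ∀ μ ν : VL → VR → ℝ,
      edgeSup Nv (fun i j => Wop Nv Nc γ β μ i j - Wop Nv Nc γ β ν i j)
        ≤ β * ((dv : ℝ) - 1) * edgeSup Nv (fun i j => μ i j - ν i j) := fun μ ν =>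
    Real.iSup_le (fun p => hLip μ ν _ (hsup fun i j => μ i j - ν i j) _ _ p.2)
      (mul_nonneg hK0 (edgeSup_nonneg _ _))
  refine ⟨hcontr, fun hK1 => ?_⟩
  obtain ⟨μs, hμs⟩ := exists_edge_fixedPoint Nv (Wop Nv Nc γ β) hK0 hK1 hLip
  refine ⟨μs, hμs, fun ν hν => ?_, ?_⟩
  · have hle : edgeSup Nv (fun i j => ν i j - μs i j)
        ≤ β * ((dv : ℝ) - 1) * edgeSup Nv (fun i j => ν i j - μs i j) := by
      refine le_of_eq_of_le (iSup_congr fun p => ?_) (hcontr ν μs)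
      beta_reduce
      rw [← hν _ _ p.2, ← hμs _ _ p.2]
    have hzero : edgeSup Nv (fun i j => ν i j - μs i j) ≤ 0 := by
      by_contra! hpos
      nlinarith
    intro i j hj
    exact sub_eq_zero.1 (abs_nonpos_iff.1 ((hsup (fun i j => ν i j - μs i j) i j hj).trans hzero))
  · have hiter : ∀ n, ∀ i, ∀ j ∈ Nv i, |wmsIter Nv Nc γ β n i j - μs i j|
        ≤ (β * ((dv : ℝ) - 1)) ^ n * edgeSup Nv (fun i j => γ i - μs i j) := by
      intro n
      induction n with
      | zero => simpa [wmsIter] using hsup fun i j => γ i - μs i j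
      | succ n ih =>
        intro i j hj
        rw [hμs i j hj, pow_succ', mul_assoc]
        simpa only [wmsIter, Function.iterate_succ_apply'] using hLip _ _ _ ih i j hj
    intro i j hj
    refine tendsto_iff_dist_tendsto_zero.2 (squeeze_zero (fun _ => dist_nonneg)
      (fun n => hiter n i j hj) ?_)
    simpa using (tendsto_pow_atTop_nhds_zero_of_lt_one hK0 hK1).mul_const
      (edgeSup Nv fun i j => γ i - μs i j)
end

section
/- Let δ ∈ (0,1) and let {μ_δ^{(ℓ)}} be the WMS iterates with parameter β = δ/(d_v−1). Suppose there are integers 0 < L_0 < L_1 such that {μ_δ^{(ℓ)}} satisfies BMP([L_0,L_1]). Then for every ℓ ≥ L_0: sgn(μ_δ^{(ℓ)}_{i→j}) = sgn(μ_δ^{(L_0)}_{i→j}) for all edges (i,j) ∈ E, and |μ_δ^{(ℓ)}_{i→j}| ≥ ‖γ‖_∞/δ for all edges (i,j) ∈ E. -/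
open Finset Filter

/-- The block-wise monotone property BMP([L0, L1]) of a sequence of WMS message vectors
(for WMS-consistency with parameter `β`, and lower bound `‖γ‖_∞/δ`). -/
def BMP {VL VR : Type*} [DecidableEq VL] [DecidableEq VR]
    (Nv : VL → Finset VR) (Nc : VR → Finset VL) (γ : VL → ℝ) (β δ : ℝ)
    (μd : ℕ → VL → VR → ℝ) (L0 L1 : ℕ) : Prop :=
  (∀ ℓ : ℕ, L0 ≤ ℓ → ℓ ≤ L1 →
    WMSConsistent Nv Nc γ β (μd ℓ) ∧
    (∀ i : VL, ∀ j ∈ Nv i, Real.sign (μd ℓ i j) = Real.sign (μd L0 i j)) ∧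
    (∀ i : VL, ∀ j ∈ Nv i, gammaSup γ / δ ≤ |μd ℓ i j|)) ∧
  (∀ i : VL, ∀ j ∈ Nv i, |μd L0 i j| ≤ |μd L1 i j|)

theorem Real.sign_mul_self_eq_abs (x : ℝ) : Real.sign x * x = |x| := by
  rcases lt_trichotomy x 0 with h | h | h
  · rw [Real.sign_of_neg h, abs_of_neg h]; ring
  · simp [h]
  · rw [Real.sign_of_pos h, abs_of_pos h]; ring

theorem Real.sign_mul_sign_self {x : ℝ} (hx : x ≠ 0) : Real.sign x * Real.sign x = 1 := by
  rcases Real.sign_apply_eq_of_ne_zero x hx with h | h <;> rw [h] <;> norm_num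

/-- A nonzero `x` positively correlated with `y` has the sign of `y`. -/
theorem Real.sign_eq_sign_of_sign_mul_pos {x y : ℝ} (h : 0 < Real.sign y * x) :
    Real.sign x = Real.sign y := by
  rcases Real.sign_apply_eq y with hy | hy | hy <;> rw [hy] at h ⊢
  · exact Real.sign_of_neg (by linarith)
  · simp at h
  · exact Real.sign_of_pos (by linarith)

theorem Real.sign_mul_eq_abs_of_sign_eq {x y : ℝ} (h : Real.sign x = Real.sign y) :
    Real.sign y * x = |x| := by
  rw [← h, Real.sign_mul_self_eq_abs]

/-- On a WMS-consistent vector, the sign of a message times a check-to-bit value that is computed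
from messages with the same signs is the minimum of the absolute values. -/
theorem WMSConsistent.sign_mul_c2b {VL VR : Type*} [DecidableEq VL] [DecidableEq VR]
    {Nv : VL → Finset VR} {Nc : VR → Finset VL} {γ : VL → ℝ} {β : ℝ} {ν μ : VL → VR → ℝ}
    (hν : WMSConsistent Nv Nc γ β ν) (hsym : ∀ (i : VL) (j : VR), j ∈ Nv i ↔ i ∈ Nc j)
    (hμ : ∀ i, ∀ j ∈ Nv i, Real.sign (μ i j) = Real.sign (ν i j))
    {i : VL} {j k : VR} (hj : j ∈ Nv i) (hk : k ∈ Nv i) :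
    Real.sign (ν i j) * c2b Nc μ i k =
      ⨅ m : {m : VL // m ∈ (Nc k).erase i}, |μ m.1 k| := by
  obtain ⟨hne, hrow, hchk, -⟩ := hν
  have hprod : ∏ m ∈ (Nc k).erase i, Real.sign (ν m k) = Real.sign (ν i k) := by
    have h := hchk i k hk
    have hinf : 0 ≤ ⨅ m : {m : VL // m ∈ (Nc k).erase i}, |ν m.1 k| :=
      Real.iInf_nonneg fun _ => abs_nonneg _
    have hpm : ∏ m ∈ (Nc k).erase i, Real.sign (ν m k) = 1 ∨
        ∏ m ∈ (Nc k).erase i, Real.sign (ν m k) = -1 := by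
      refine Finset.prod_induction _ (fun x : ℝ => x = 1 ∨ x = -1) ?_ (Or.inl rfl) ?_
      · rintro a b (rfl | rfl) (rfl | rfl) <;> norm_num
      · intro m hm
        exact (Real.sign_apply_eq_of_ne_zero _
          (hne m k ((hsym m k).2 (Finset.mem_of_mem_erase hm)))).symm
    have hpos : 0 < ⨅ m : {m : VL // m ∈ (Nc k).erase i}, |ν m.1 k| := by
      refine lt_of_le_of_ne hinf fun h0 => ?_
      rw [c2b, ← h0, mul_zero, Real.sign_zero] at h
      exact hne i k hk (Real.sign_eq_zero_iff.1 h.symm)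
    rw [← h, c2b]
    rcases hpm with hp | hp <;> rw [hp]
    · rw [one_mul, Real.sign_of_pos hpos]
    · rw [Real.sign_of_neg (by linarith)]
  rw [c2b, Finset.prod_congr rfl fun m hm =>
    hμ m k ((hsym m k).2 (Finset.mem_of_mem_erase hm)), hprod, hrow i j hj k hk, ← mul_assoc,
    Real.sign_mul_sign_self (hne i k hk), one_mul]

/-- The WMS operator is monotone on message vectors sharing the signs of a WMS-consistent one. -/
theorem WMSConsistent.sign_mul_Wop_le {VL VR : Type*} [DecidableEq VL] [DecidableEq VR]
    {Nv : VL → Finset VR} {Nc : VR → Finset VL} {γ : VL → ℝ} {β : ℝ} {ν μ μ' : VL → VR → ℝ}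
    (hν : WMSConsistent Nv Nc γ β ν) (hsym : ∀ (i : VL) (j : VR), j ∈ Nv i ↔ i ∈ Nc j)
    (hβ : 0 ≤ β) (hμ : ∀ i, ∀ j ∈ Nv i, 0 < Real.sign (ν i j) * μ i j)
    (hle : ∀ i, ∀ j ∈ Nv i, Real.sign (ν i j) * μ i j ≤ Real.sign (ν i j) * μ' i j)
    {i : VL} {j : VR} (hj : j ∈ Nv i) :
    Real.sign (ν i j) * Wop Nv Nc γ β μ i j ≤ Real.sign (ν i j) * Wop Nv Nc γ β μ' i j := by
  have hs : ∀ i, ∀ j ∈ Nv i, Real.sign (μ i j) = Real.sign (ν i j) := fun i j hj =>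
    Real.sign_eq_sign_of_sign_mul_pos (hμ i j hj)
  have hs' : ∀ i, ∀ j ∈ Nv i, Real.sign (μ' i j) = Real.sign (ν i j) := fun i j hj =>
    Real.sign_eq_sign_of_sign_mul_pos ((hμ i j hj).trans_le (hle i j hj))
  simp only [Wop, mul_add, mul_left_comm (Real.sign (ν i j)) β, Finset.mul_sum]
  refine add_le_add le_rfl (Finset.sum_le_sum fun k hk => mul_le_mul_of_nonneg_left ?_ hβ)
  replace hk := Finset.mem_of_mem_erase hk
  rw [hν.sign_mul_c2b hsym hs hj hk, hν.sign_mul_c2b hsym hs' hj hk]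
  refine ciInf_mono ⟨0, ?_⟩ fun m => ?_
  · rintro _ ⟨m, rfl⟩
    exact abs_nonneg _
  · have hm := (hsym m.1 k).2 (Finset.mem_of_mem_erase m.2)
    rw [← Real.sign_mul_eq_abs_of_sign_eq (hs m.1 k hm),
      ← Real.sign_mul_eq_abs_of_sign_eq (hs' m.1 k hm)]
    exact hle m.1 k hm

/-- If the WMS iterates with parameter `δ/(d_v−1)` satisfy BMP([L0,L1]),
then for every `ℓ ≥ L0` the messages keep the signs of time `L0` and have absolute value at
least `‖γ‖_∞/δ`. -/
theorem wms_bmp_extend_to_half_line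
    {VL VR : Type*} [Fintype VL] [Fintype VR] [DecidableEq VL] [DecidableEq VR]
    [Nonempty VL] [Nonempty VR]
    (Nv : VL → Finset VR) (Nc : VR → Finset VL) (dv dc : ℕ)
    (hsym : ∀ (i : VL) (j : VR), j ∈ Nv i ↔ i ∈ Nc j)
    (hdv : ∀ i : VL, (Nv i).card = dv) (hdc : ∀ j : VR, (Nc j).card = dc)
    (hdv2 : 2 ≤ dv) (hdc2 : 2 ≤ dc)
    (γ : VL → ℝ) (δ : ℝ) (hδ0 : 0 < δ) (hδ1 : δ < 1)
    (μd : ℕ → VL → VR → ℝ)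
    (hμd : μd = wmsIter Nv Nc γ (δ / ((dv : ℝ) - 1)))
    (L0 L1 : ℕ) (hL0 : 0 < L0) (hL : L0 < L1)
    (hbmp : BMP Nv Nc γ (δ / ((dv : ℝ) - 1)) δ μd L0 L1) :
    ∀ ℓ : ℕ, L0 ≤ ℓ →
      (∀ i : VL, ∀ j ∈ Nv i, Real.sign (μd ℓ i j) = Real.sign (μd L0 i j)) ∧
      (∀ i : VL, ∀ j ∈ Nv i, gammaSup γ / δ ≤ |μd ℓ i j|) := by
  obtain ⟨hblock, hmono⟩ := hbmp
  obtain ⟨hcons, -, -⟩ := hblock L0 le_rfl hL.le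
  have hβ : 0 ≤ δ / ((dv : ℝ) - 1) := by
    have : (2 : ℝ) ≤ dv := by exact_mod_cast hdv2
    exact div_nonneg hδ0.le (by linarith)
  have hstep : ∀ ℓ, μd (ℓ + 1) = Wop Nv Nc γ (δ / ((dv : ℝ) - 1)) (μd ℓ) := fun ℓ => by
    rw [hμd]
    exact Function.iterate_succ_apply' _ _ _
  obtain ⟨T, rfl⟩ := Nat.exists_eq_add_of_lt hL
  have key : ∀ n,
      (∀ ℓ, L0 ≤ ℓ → ℓ ≤ L0 + n + (T + 1) → ∀ i, ∀ j ∈ Nv i,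
        0 < Real.sign (μd L0 i j) * μd ℓ i j ∧
          gammaSup γ / δ ≤ Real.sign (μd L0 i j) * μd ℓ i j) ∧
      ∀ i, ∀ j ∈ Nv i, Real.sign (μd L0 i j) * μd (L0 + n) i j ≤
        Real.sign (μd L0 i j) * μd (L0 + n + (T + 1)) i j := by
    intro n
    induction n with
    | zero =>
      refine ⟨fun ℓ h0 h1 i j hj => ?_, fun i j hj => ?_⟩
      · obtain ⟨hc, hs, hb⟩ := hblock ℓ h0 (by omega)
        rw [Real.sign_mul_eq_abs_of_sign_eq (hs i j hj)]
        exact ⟨abs_pos.2 (hc.1 i j hj), hb i j hj⟩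
      · have hs := (hblock _ (by omega) le_rfl).2.1 i j hj
        exact (Real.sign_mul_self_eq_abs _).trans_le
          ((hmono i j hj).trans_eq (Real.sign_mul_eq_abs_of_sign_eq hs).symm)
    | succ n ih =>
      obtain ⟨hlow, hle⟩ := ih
      have hle' : ∀ i, ∀ j ∈ Nv i, Real.sign (μd L0 i j) * μd (L0 + (n + 1)) i j ≤
          Real.sign (μd L0 i j) * μd (L0 + (n + 1) + (T + 1)) i j := fun i j hj => by
        rw [show L0 + (n + 1) + (T + 1) = L0 + n + (T + 1) + 1 by omega, ← add_assoc L0 n 1,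
          hstep, hstep (L0 + n + (T + 1))]
        exact hcons.sign_mul_Wop_le hsym hβ
          (fun i j hj => (hlow _ (by omega) (by omega) i j hj).1) hle hj
      refine ⟨fun ℓ h0 h1 i j hj => ?_, hle'⟩
      rcases h1.lt_or_eq with h | rfl
      · exact hlow ℓ h0 (by omega) i j hj
      · obtain ⟨hp, hb⟩ := hlow (L0 + (n + 1)) (by omega) (by omega) i j hj
        exact ⟨hp.trans_le (hle' i j hj), hb.trans (hle' i j hj)⟩
  intro ℓ hℓ
  have h := (key ℓ).1 ℓ hℓ (by omega)
  have hs : ∀ i, ∀ j ∈ Nv i, Real.sign (μd ℓ i j) = Real.sign (μd L0 i j) := fun i j hj =>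
    Real.sign_eq_sign_of_sign_mul_pos (h i j hj).1
  exact ⟨hs, fun i j hj => (h i j hj).2.trans_eq (Real.sign_mul_eq_abs_of_sign_eq (hs i j hj))⟩
end

section
/- Let δ ∈ [0,1], let {μ^{(ℓ)}} be the WMS iterates with parameter β = 1/(d_v−1), and let {μ_δ^{(ℓ)}} be the WMS iterates with parameter β = δ/(d_v−1) (both initialized by μ^{(0)}_{i→j} = μ_δ^{(0)}_{i→j} = γ_i). Then for every ℓ ≥ 0: ‖μ^{(ℓ)} − μ_δ^{(ℓ)}‖_∞ ≤ (1−δ)·(ℓ(ℓ+1)/2)·‖γ‖_∞. Consequently, for any ε > 0 and integer L > 0, choosing δ ≥ 1 − 2ε/(L(L+1)‖γ‖_∞) (when γ ≠ 0) ensures ‖μ^{(ℓ)} − μ_δ^{(ℓ)}‖_∞ ≤ ε for all ℓ ≤ L. -/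
open Finset Filter

theorem abs_sign_le_one (x : ℝ) : |Real.sign x| ≤ 1 := by
  rcases Real.sign_apply_eq x with h | h | h <;> simp [h]

theorem abs_add_abs_eq_abs_sub_of_sign_ne {x y : ℝ} (h : Real.sign x ≠ Real.sign y) :
    |x| + |y| = |x - y| := by
  rcases lt_trichotomy x 0 with hx | rfl | hx
  · rcases lt_trichotomy y 0 with hy | rfl | hy
    · exact absurd (by rw [Real.sign_of_neg hx, Real.sign_of_neg hy]) h
    · simp
    · rw [abs_of_neg hx, abs_of_pos hy, abs_of_neg (by linarith)]; ring
  · simp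
  · rcases lt_trichotomy y 0 with hy | rfl | hy
    · rw [abs_of_pos hx, abs_of_neg hy, abs_of_pos (by linarith)]; ring
    · simp
    · exact absurd (by rw [Real.sign_of_pos hx, Real.sign_of_pos hy]) h

theorem iInf_abs_le {ι : Type*} (s : Finset ι) (x : ι → ℝ) {m : ι} (hm : m ∈ s) :
    ⨅ m : {m : ι // m ∈ s}, |x m.1| ≤ |x m| :=
  ciInf_le (f := fun m : {m : ι // m ∈ s} => |x m.1|)
    ⟨0, by rintro _ ⟨_, rfl⟩; exact abs_nonneg _⟩ ⟨m, hm⟩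

theorem abs_prod_sign_mul_iInf_le {ι : Type*} (s : Finset ι) (x : ι → ℝ) :
    |(∏ m ∈ s, Real.sign (x m)) * (⨅ m : {m : ι // m ∈ s}, |x m.1|)|
      ≤ ⨅ m : {m : ι // m ∈ s}, |x m.1| := by
  have h0 : 0 ≤ ⨅ m : {m : ι // m ∈ s}, |x m.1| := Real.iInf_nonneg fun _ => abs_nonneg _
  rw [abs_mul, abs_of_nonneg h0]
  exact mul_le_of_le_one_left h0 (abs_prod_sign_le_one s x)

theorem iInf_abs_le_iInf_abs_add {ι : Type*} {s : Finset ι} (hs : s.Nonempty) {x y : ι → ℝ}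
    {t : ℝ} (h : ∀ m ∈ s, |x m - y m| ≤ t) :
    ⨅ m : {m : ι // m ∈ s}, |x m.1| ≤ (⨅ m : {m : ι // m ∈ s}, |y m.1|) + t := by
  have : Nonempty {m : ι // m ∈ s} := hs.to_subtype
  rw [← sub_le_iff_le_add]
  refine le_ciInf fun m => ?_
  have h1 := iInf_abs_le s x m.2
  have h2 := abs_sub_abs_le_abs_sub (x m.1) (y m.1)
  linarith [h m.1 m.2]

/-- The product of signs times the minimum modulus is `1`-Lipschitz in the sup-norm. -/
theorem abs_prod_sign_mul_iInf_sub_le {ι : Type*} {s : Finset ι} (hs : s.Nonempty)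
    {x y : ι → ℝ} {t : ℝ} (h : ∀ m ∈ s, |x m - y m| ≤ t) :
    |(∏ m ∈ s, Real.sign (x m)) * (⨅ m : {m : ι // m ∈ s}, |x m.1|) -
      (∏ m ∈ s, Real.sign (y m)) * (⨅ m : {m : ι // m ∈ s}, |y m.1|)| ≤ t := by
  by_cases hsg : ∀ m ∈ s, Real.sign (x m) = Real.sign (y m)
  · rw [Finset.prod_congr rfl hsg, ← mul_sub, abs_mul]
    refine (mul_le_of_le_one_left (abs_nonneg _) (abs_prod_sign_le_one s y)).trans ?_
    have h1 := iInf_abs_le_iInf_abs_add hs h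
    have h2 := iInf_abs_le_iInf_abs_add (x := y) (y := x) hs
      fun m hm => (abs_sub_comm _ _).trans_le (h m hm)
    exact abs_sub_le_iff.2 ⟨by linarith, by linarith⟩
  · push Not at hsg
    obtain ⟨m, hm, hne⟩ := hsg
    refine (abs_sub _ _).trans ?_
    have := abs_add_abs_eq_abs_sub_of_sign_ne hne
    linarith [abs_prod_sign_mul_iInf_le s x, abs_prod_sign_mul_iInf_le s y,
      iInf_abs_le s x hm, iInf_abs_le s y hm, h m hm]

theorem abs_sum_le_card_mul {ι : Type*} {s : Finset ι} {f : ι → ℝ} {B : ℝ}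
    (h : ∀ k ∈ s, |f k| ≤ B) : |∑ k ∈ s, f k| ≤ s.card * B :=
  (Finset.abs_sum_le_sum_abs _ _).trans <| by
    simpa [nsmul_eq_mul] using Finset.sum_le_card_nsmul s (fun k => |f k|) B h

theorem abs_le_gammaSup {VL : Type*} [Finite VL] (γ : VL → ℝ) (i : VL) : |γ i| ≤ gammaSup γ :=
  le_ciSup (f := fun i => |γ i|) (Set.finite_range _).bddAbove i

theorem gammaSup_nonneg {VL : Type*} (γ : VL → ℝ) : 0 ≤ gammaSup γ :=
  Real.iSup_nonneg fun _ => abs_nonneg _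

theorem gammaSup_pos {VL : Type*} [Finite VL] {γ : VL → ℝ} (h : γ ≠ 0) : 0 < gammaSup γ := by
  obtain ⟨i, hi⟩ := Function.ne_iff.1 h
  exact (abs_pos.2 hi).trans_le (abs_le_gammaSup γ i)

theorem wmsIter_succ {VL VR : Type*} [DecidableEq VL] [DecidableEq VR]
    (Nv : VL → Finset VR) (Nc : VR → Finset VL) (γ : VL → ℝ) (β : ℝ) (n : ℕ) (i : VL) (j : VR) :
    wmsIter Nv Nc γ β (n + 1) i j =
      γ i + β * ∑ k ∈ (Nv i).erase j, c2b Nc (wmsIter Nv Nc γ β n) i k := by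
  simp only [wmsIter, Function.iterate_succ_apply', Wop]

theorem erase_check_nonempty {VL VR : Type*} [DecidableEq VL] {Nc : VR → Finset VL}
    (hc : ∀ k : VR, 2 ≤ (Nc k).card) (i : VL) (k : VR) :
    ((Nc k).erase i).Nonempty := by
  have h1 := hc k
  have h2 := Finset.pred_card_le_card_erase (s := Nc k) (a := i)
  exact Finset.card_pos.1 (by omega)

theorem card_erase_cast {VL VR : Type*} [DecidableEq VR] {Nv : VL → Finset VR} {dv : ℕ}
    (hdv : ∀ i : VL, (Nv i).card = dv) {i : VL} {j : VR} (hj : j ∈ Nv i) :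
    (((Nv i).erase j).card : ℝ) = (dv : ℝ) - 1 := by
  rw [Finset.cast_card_erase_of_mem hj, hdv]

section TannerGraph

variable {VL VR : Type*} [DecidableEq VL]
  {Nv : VL → Finset VR} {Nc : VR → Finset VL} {dv : ℕ}

theorem abs_c2b_le (hsym : ∀ (i : VL) (j : VR), j ∈ Nv i ↔ i ∈ Nc j)
    (hc : ∀ k : VR, 2 ≤ (Nc k).card) {μ : VL → VR → ℝ} {B : ℝ}
    (h : ∀ i, ∀ j ∈ Nv i, |μ i j| ≤ B) (i : VL) (k : VR) : |c2b Nc μ i k| ≤ B := by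
  obtain ⟨m, hm⟩ := erase_check_nonempty hc i k
  exact (abs_prod_sign_mul_iInf_le _ fun m => μ m k).trans <|
    (iInf_abs_le _ (fun m => μ m k) hm).trans <| h m k <| (hsym m k).2 (Finset.mem_of_mem_erase hm)

theorem abs_c2b_sub_le_s14 (hsym : ∀ (i : VL) (j : VR), j ∈ Nv i ↔ i ∈ Nc j)
    (hc : ∀ k : VR, 2 ≤ (Nc k).card) {μ ν : VL → VR → ℝ} {t : ℝ}
    (h : ∀ i, ∀ j ∈ Nv i, |μ i j - ν i j| ≤ t) (i : VL) (k : VR) :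
    |c2b Nc μ i k - c2b Nc ν i k| ≤ t :=
  abs_prod_sign_mul_iInf_sub_le (erase_check_nonempty hc i k) fun m hm =>
    h m k ((hsym m k).2 (Finset.mem_of_mem_erase hm))

theorem abs_wmsIter_le [DecidableEq VR] [Finite VL]
    (hsym : ∀ (i : VL) (j : VR), j ∈ Nv i ↔ i ∈ Nc j)
    (hdv : ∀ i : VL, (Nv i).card = dv) (hc : ∀ k : VR, 2 ≤ (Nc k).card)
    (γ : VL → ℝ) {β : ℝ} (hβ0 : 0 ≤ β) (hβ1 : β * ((dv : ℝ) - 1) ≤ 1) (n : ℕ) :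
    ∀ i, ∀ j ∈ Nv i, |wmsIter Nv Nc γ β n i j| ≤ ((n : ℝ) + 1) * gammaSup γ := by
  induction n with
  | zero => intro i j _; simpa [wmsIter] using abs_le_gammaSup γ i
  | succ n ih =>
    intro i j hj
    rw [wmsIter_succ]
    have hsum := abs_sum_le_card_mul (s := (Nv i).erase j)
      fun k _ => abs_c2b_le hsym hc ih i k
    rw [card_erase_cast hdv hj] at hsum
    have hB : 0 ≤ ((n : ℝ) + 1) * gammaSup γ := mul_nonneg (by positivity) (gammaSup_nonneg γ)
    have hmul := mul_le_mul_of_nonneg_left hsum hβ0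
    have hone := mul_le_mul_of_nonneg_right hβ1 hB
    refine (abs_add_le _ _).trans ?_
    rw [abs_mul, abs_of_nonneg hβ0]
    push_cast
    linarith [abs_le_gammaSup γ i]

theorem abs_wmsIter_sub_le [DecidableEq VR] [Finite VL]
    (hsym : ∀ (i : VL) (j : VR), j ∈ Nv i ↔ i ∈ Nc j)
    (hdv : ∀ i : VL, (Nv i).card = dv) (hdv2 : 2 ≤ dv) (hc : ∀ k : VR, 2 ≤ (Nc k).card)
    (γ : VL → ℝ) {δ : ℝ} (hδ0 : 0 ≤ δ) (hδ1 : δ ≤ 1) (n : ℕ) :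
    ∀ i, ∀ j ∈ Nv i,
      |wmsIter Nv Nc γ (1 / ((dv : ℝ) - 1)) n i j - wmsIter Nv Nc γ (δ / ((dv : ℝ) - 1)) n i j|
        ≤ (1 - δ) * ((n : ℝ) * ((n : ℝ) + 1) / 2) * gammaSup γ := by
  have hd : (0 : ℝ) < (dv : ℝ) - 1 := by
    have : (2 : ℝ) ≤ dv := by exact_mod_cast hdv2
    linarith
  induction n with
  | zero => intro i j _; simp [wmsIter]
  | succ n ih =>
    intro i j hj
    have hbound := abs_wmsIter_le hsym hdv hc γ (β := δ / ((dv : ℝ) - 1)) (by positivity)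
      (by rwa [div_mul_cancel₀ _ hd.ne']) n
    rw [wmsIter_succ, wmsIter_succ]
    set μ := wmsIter Nv Nc γ (1 / ((dv : ℝ) - 1)) n
    set ν := wmsIter Nv Nc γ (δ / ((dv : ℝ) - 1)) n
    have hdiff := abs_sum_le_card_mul (s := (Nv i).erase j)
      fun k _ => abs_c2b_sub_le_s14 hsym hc ih i k
    have hsize := abs_sum_le_card_mul (s := (Nv i).erase j)
      fun k _ => abs_c2b_le hsym hc hbound i k
    rw [card_erase_cast hdv hj, ← div_le_iff₀' hd] at hdiff hsize
    rw [Finset.sum_sub_distrib] at hdiff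
    set S := ∑ k ∈ (Nv i).erase j, c2b Nc μ i k
    set T := ∑ k ∈ (Nv i).erase j, c2b Nc ν i k
    have hsplit : γ i + 1 / ((dv : ℝ) - 1) * S - (γ i + δ / ((dv : ℝ) - 1) * T) =
        (S - T) / ((dv : ℝ) - 1) + (1 - δ) * (T / ((dv : ℝ) - 1)) := by ring
    have hscaled := mul_le_mul_of_nonneg_left hsize (sub_nonneg.2 hδ1)
    rw [hsplit]
    refine (abs_add_le _ _).trans ?_
    rw [abs_mul, abs_div, abs_div, abs_of_pos hd, abs_of_nonneg (sub_nonneg.2 hδ1)]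
    push_cast
    linarith

end TannerGraph

/-- The WMS iterates with parameters `1/(d_v−1)` and `δ/(d_v−1)` stay
within `(1−δ)·ℓ(ℓ+1)/2·‖γ‖_∞` of each other after `ℓ` iterations; consequently, given
`ε > 0` and `L > 0`, any `δ ≥ 1 − 2ε/(L(L+1)‖γ‖_∞)` keeps them within `ε` for all `ℓ ≤ L`. -/
theorem wms_iterates_close_for_delta_near_one
    {VL VR : Type*} [Fintype VL] [Fintype VR] [DecidableEq VL] [DecidableEq VR]
    [Nonempty VL] [Nonempty VR]
    (Nv : VL → Finset VR) (Nc : VR → Finset VL) (dv dc : ℕ)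
    (hsym : ∀ (i : VL) (j : VR), j ∈ Nv i ↔ i ∈ Nc j)
    (hdv : ∀ i : VL, (Nv i).card = dv) (hdc : ∀ j : VR, (Nc j).card = dc)
    (hdv2 : 2 ≤ dv) (hdc2 : 2 ≤ dc)
    (γ : VL → ℝ) (δ : ℝ) (hδ0 : 0 ≤ δ) (hδ1 : δ ≤ 1)
    (μ1 μd : ℕ → VL → VR → ℝ)
    (hμ1 : μ1 = wmsIter Nv Nc γ (1 / ((dv : ℝ) - 1)))
    (hμd : μd = wmsIter Nv Nc γ (δ / ((dv : ℝ) - 1))) :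
    (∀ ℓ : ℕ, ∀ i : VL, ∀ j ∈ Nv i,
      |μ1 ℓ i j - μd ℓ i j| ≤ (1 - δ) * ((ℓ : ℝ) * ((ℓ : ℝ) + 1) / 2) * gammaSup γ) ∧
    (∀ ε : ℝ, 0 < ε → ∀ L : ℕ, 0 < L → γ ≠ 0 →
      1 - 2 * ε / ((L : ℝ) * ((L : ℝ) + 1) * gammaSup γ) ≤ δ →
      ∀ ℓ : ℕ, ℓ ≤ L → ∀ i : VL, ∀ j ∈ Nv i, |μ1 ℓ i j - μd ℓ i j| ≤ ε) := by
  subst hμ1 hμd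
  have main := abs_wmsIter_sub_le hsym hdv hdv2 (fun k => hdc2.trans_eq (hdc k).symm) γ hδ0 hδ1
  refine ⟨main, fun ε _ L hL hγ hδ ℓ hℓ i j hj => (main ℓ i j hj).trans ?_⟩
  have hG := gammaSup_pos hγ
  have hL0 : (0 : ℝ) < L := by exact_mod_cast hL
  have hℓL : (ℓ : ℝ) ≤ L := by exact_mod_cast hℓ
  have hδ' : 1 - δ ≤ 2 * ε / ((L : ℝ) * ((L : ℝ) + 1) * gammaSup γ) := by linarith
  rw [le_div_iff₀ (by positivity)] at hδ'
  have hmono : (1 - δ) * ((ℓ : ℝ) * ((ℓ : ℝ) + 1) / 2) * gammaSup γ ≤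
      (1 - δ) * ((L : ℝ) * ((L : ℝ) + 1) / 2) * gammaSup γ := by
    have := sub_nonneg.2 hδ1
    gcongr
  linarith
end
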